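/- Let n ∈ ℕ and L, C, R ∈ ℝ_max^{n×n}, and consider the lifted system with matrices Ā, B̄, H and semimodule K = Im H*. Then the following two conditions together — (a) the sequence φ^k(K) converges in at most n²-1 steps, i.e., φ^k(K) = φ^{n²-1}(K) for all k ≥ n²-1, and (b) K^♯ ∩ ℝ^{2n} ≠ ∅ — hold if and only if the system (8) is consistent. -/

import Mathlib

noncomputable section

open scoped Classical

/-- Max-plus matrix-vector product: `(A ⊗ x)_i = sup_j (A_{ij} + x_j)`. -/
def mpMulVec {N P : Type*} (A : N → P → EReal) (x : P → EReal) : N → EReal :=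
  fun i => ⨆ j, A i j + x j

/-- Max-plus matrix-matrix product. -/
def mpMulMat {N P Q : Type*} (A : N → P → EReal) (B : P → Q → EReal) : N → Q → EReal :=
  fun i j => ⨆ k, A i k + B k j

/-- Max-plus identity matrix `E`. -/
def mpId {N : Type*} [DecidableEq N] : N → N → EReal :=
  fun i j => if i = j then (0 : EReal) else ⊥

/-- Max-plus matrix powers: `A^0 = E`, `A^{k+1} = A^k ⊗ A`. -/
def mpPow {N : Type*} [DecidableEq N] (A : N → N → EReal) : ℕ → N → N → EReal
  | 0 => mpId
  | k + 1 => mpMulMat (mpPow A k) A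

/-- Kleene star `A* = sup_{k ≥ 0} A^k` (entrywise supremum). -/
def mpStar {N : Type*} [DecidableEq N] (A : N → N → EReal) : N → N → EReal :=
  fun i j => ⨆ k : ℕ, mpPow A k i j

/-- Image of a matrix: `Im U = { U ⊗ u : u ∈ ℝ_max^P } ⊆ ℝ_max^N`. -/
def mpIm {N P : Type*} (U : N → P → EReal) : Set (N → EReal) :=
  { x | (∀ i, x i ≠ ⊤) ∧ ∃ u : P → EReal, (∀ j, u j ≠ ⊤) ∧ x = mpMulVec U u }

/-- Existence of a positive-weight circuit in the precedence graph `G(A)`. -/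
def hasPosCircuit {N : Type*} (A : N → N → EReal) : Prop :=
  ∃ (l : ℕ) (p : ℕ → N), p l = p 0 ∧ (∀ t < l, A (p (t + 1)) (p t) ≠ ⊥) ∧
    0 < ∑ t ∈ Finset.range l, A (p (t + 1)) (p t)

/-- The block-tridiagonal matrix `M_[K]` with diagonal blocks `C`,
superdiagonal blocks `L`, subdiagonal blocks `R`. -/
def MK {n : ℕ} (L C R : Fin n → Fin n → EReal) (K : ℕ) :
    Fin K × Fin n → Fin K × Fin n → EReal :=
  fun p q =>
    if p.1.val = q.1.val then C p.2 q.2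
    else if p.1.val + 1 = q.1.val then L p.2 q.2
    else if q.1.val + 1 = p.1.val then R p.2 q.2
    else ⊥

/-- The infinite block-tridiagonal matrix `M_[∞]`, indexed by `ℕ × Fin n`. -/
def Minf {n : ℕ} (L C R : Fin n → Fin n → EReal) :
    ℕ × Fin n → ℕ × Fin n → EReal :=
  fun p q =>
    if p.1 = q.1 then C p.2 q.2
    else if p.1 + 1 = q.1 then L p.2 q.2
    else if q.1 + 1 = p.1 then R p.2 q.2
    else ⊥

/-- Existence of a finite real trajectory `x : {1,…,K} → ℝ^n` satisfying
`x(k) ≥ C ⊗ x(k)`, `x(k) ≥ L ⊗ x(k+1)` and `x(k+1) ≥ R ⊗ x(k)`. -/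
def FiniteTraj {n : ℕ} (L C R : Fin n → Fin n → EReal) (K : ℕ) : Prop :=
  ∃ x : Fin K → Fin n → ℝ,
    (∀ k : Fin K, ∀ i, mpMulVec C (fun j => (x k j : EReal)) i ≤ (x k i : EReal)) ∧
    (∀ k : Fin K, ∀ h : k.val + 1 < K, ∀ i,
      mpMulVec L (fun j => (x ⟨k.val + 1, h⟩ j : EReal)) i ≤ (x k i : EReal) ∧
      mpMulVec R (fun j => (x k j : EReal)) i ≤ (x ⟨k.val + 1, h⟩ i : EReal))

/-- Weak consistency of system (8). -/
def WeaklyConsistent {n : ℕ} (L C R : Fin n → Fin n → EReal) : Prop :=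
  ∀ K : ℕ, FiniteTraj L C R K

/-- Consistency of system (8): existence of an infinite real trajectory. -/
def Consistent {n : ℕ} (L C R : Fin n → Fin n → EReal) : Prop :=
  ∃ x : ℕ → Fin n → ℝ, ∀ k : ℕ,
    (∀ i, mpMulVec L (fun j => (x (k + 1) j : EReal)) i ≤ (x k i : EReal)) ∧
    (∀ i, mpMulVec C (fun j => (x k j : EReal)) i ≤ (x k i : EReal)) ∧
    (∀ i, mpMulVec R (fun j => (x k j : EReal)) i ≤ (x (k + 1) i : EReal))

/-- The sequence `Π_0 = C*`, `Π_{k+1} = (L ⊗ Π_k ⊗ R ⊕ C)*`. -/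
def PiSeq {n : ℕ} (L C R : Fin n → Fin n → EReal) : ℕ → Fin n → Fin n → EReal
  | 0 => mpStar C
  | k + 1 => mpStar (fun i j => max (mpMulMat (mpMulMat L (PiSeq L C R k)) R i j) (C i j))

/-- Lifted matrix `Ā = [[ε, E], [ε, ε]]`. -/
def Abar (n : ℕ) : Fin n ⊕ Fin n → Fin n ⊕ Fin n → EReal :=
  fun p q =>
    match p, q with
    | Sum.inl i, Sum.inr j => mpId i j
    | _, _ => ⊥

/-- Lifted matrix `B̄ = [ε; E]`. -/
def Bbar (n : ℕ) : Fin n ⊕ Fin n → Fin n → EReal :=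
  fun p j =>
    match p with
    | Sum.inl _ => ⊥
    | Sum.inr i => mpId i j

/-- Lifted matrix `H = [[C, L], [R, C]]`. -/
def Hmat {n : ℕ} (L C R : Fin n → Fin n → EReal) :
    Fin n ⊕ Fin n → Fin n ⊕ Fin n → EReal :=
  fun p q =>
    match p, q with
    | Sum.inl i, Sum.inl j => C i j
    | Sum.inl i, Sum.inr j => L i j
    | Sum.inr i, Sum.inl j => R i j
    | Sum.inr i, Sum.inr j => C i j

/-- The semimodule `K = Im H*`. -/
def Kset {n : ℕ} (L C R : Fin n → Fin n → EReal) : Set (Fin n ⊕ Fin n → EReal) :=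
  mpIm (mpStar (Hmat L C R))

/-- The map `φ(X) = X ∩ { x ∈ ℝ_max^N : ∃ u ∈ ℝ_max^M, A ⊗ x ⊕ B ⊗ u ∈ X }`. -/
def mpPhi {N M : Type*} (A : N → N → EReal) (B : N → M → EReal)
    (X : Set (N → EReal)) : Set (N → EReal) :=
  X ∩ { x | (∀ i, x i ≠ ⊤) ∧ ∃ u : M → EReal, (∀ j, u j ≠ ⊤) ∧
    (fun i => max (mpMulVec A x i) (mpMulVec B u i)) ∈ X }

/-- Controlled trajectory: `x(1) = x0`, `x(k+1) = A ⊗ x(k) ⊕ B ⊗ u(k)`. -/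
def mpTraj {N M : Type*} (A : N → N → EReal) (B : N → M → EReal)
    (x0 : N → EReal) (u : ℕ → M → EReal) : ℕ → N → EReal
  | 0 => x0
  | k + 1 => fun i => max (mpMulVec A (mpTraj A B x0 u k) i) (mpMulVec B (u k) i)

/-- `K^♯`: states of `K` from which some control keeps the whole trajectory in `K`. -/
def mpKsharp {N M : Type*} (A : N → N → EReal) (B : N → M → EReal)
    (K : Set (N → EReal)) : Set (N → EReal) :=
  { x | x ∈ K ∧ ∃ u : ℕ → M → EReal, (∀ k j, u k j ≠ ⊤) ∧
    ∀ k : ℕ, mpTraj A B x u k ∈ K }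

/-- Real vectors `ℝ^N` inside `ℝ̄^N`. -/
def RealVecs {N : Type*} : Set (N → EReal) := { x | ∀ i, x i ≠ ⊤ ∧ x i ≠ ⊥ }

/-- Semimodules of `ℝ_max^N`: closed under entrywise max and scalar addition. -/
def IsSemimodule {N : Type*} (X : Set (N → EReal)) : Prop :=
  (∀ x ∈ X, ∀ i, x i ≠ ⊤) ∧
  (∀ x ∈ X, ∀ y ∈ X, (fun i => max (x i) (y i)) ∈ X) ∧
  (∀ x ∈ X, ∀ lam : EReal, lam ≠ ⊤ → (fun i => lam + x i) ∈ X)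

/-- Embedding of the first two block indices into `Fin (k+2) × Fin n`. -/
def emb2 {n : ℕ} (k : ℕ) : Fin n ⊕ Fin n → Fin (k + 2) × Fin n
  | Sum.inl i => (⟨0, by omega⟩, i)
  | Sum.inr i => (⟨1, by omega⟩, i)

/-- `S_{k+2}`: top-left `2n × 2n` submatrix of `(M_[k+2])*`. -/
def Smat {n : ℕ} (L C R : Fin n → Fin n → EReal) (k : ℕ) :
    Fin n ⊕ Fin n → Fin n ⊕ Fin n → EReal :=
  fun p q => mpStar (MK L C R (k + 2)) (emb2 k p) (emb2 k q)

/-- Embedding of the first two block indices into `ℕ × Fin n`. -/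
def embInf {n : ℕ} : Fin n ⊕ Fin n → ℕ × Fin n
  | Sum.inl i => (0, i)
  | Sum.inr i => (1, i)

/-- `S_∞`: top-left `2n × 2n` submatrix of `(M_[∞])*`. -/
def Sinf {n : ℕ} (L C R : Fin n → Fin n → EReal) :
    Fin n ⊕ Fin n → Fin n ⊕ Fin n → EReal :=
  fun p q => mpStar (Minf L C R) (embInf p) (embInf q)

section Vectors

variable {n : ℕ}

lemma mpMulVec_le_iff {N P : Type*} (A : N → P → EReal) (x : P → EReal) (i : N) (a : EReal) :
    mpMulVec A x i ≤ a ↔ ∀ j, A i j + x j ≤ a :=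
  iSup_le_iff

lemma ereal_coe_add_le_iff (r : ℝ) (a b : EReal) : (r : EReal) + a ≤ b ↔ a ≤ b - r := by
  rw [EReal.le_sub_iff_add_le (Or.inl (EReal.coe_ne_bot r)) (Or.inl (EReal.coe_ne_top r)),
    add_comm]

lemma ereal_add_iSup_le {ι : Sort*} {a b : EReal} (ha : a ≠ ⊤) (f : ι → EReal)
    (h : ∀ i, a + f i ≤ b) : a + ⨆ i, f i ≤ b := by
  induction a with
  | bot => simp
  | top => exact absurd rfl ha
  | coe r =>
    rw [ereal_coe_add_le_iff]
    exact iSup_le fun i => (ereal_coe_add_le_iff _ _ _).1 (h i)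

lemma add_mpPow_le_mpPow_succ {N : Type*} [DecidableEq N] (A : N → N → EReal)
    (hA : ∀ i j, A i j ≠ ⊤) (k : ℕ) (i j l : N) : A i j + mpPow A k j l ≤ mpPow A (k + 1) i l := by
  induction k generalizing l with
  | zero =>
    by_cases h : j = l
    · subst h
      refine le_trans (le_of_eq ?_) (le_iSup (fun m => mpPow A 0 i m + A m j) i)
      simp [mpPow, mpId]
    · simp [mpPow, mpId, h]
  | succ k ih =>
    refine ereal_add_iSup_le (hA i j) _ fun m => ?_
    rw [← add_assoc]
    exact (add_le_add_left (ih m) _).trans (le_iSup (fun m => mpPow A (k + 1) i m + A m l) m)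

/-- The image of the Kleene star of `A` is the set of subfixed points of `A`. -/
lemma mem_mpIm_mpStar_iff {N : Type*} [DecidableEq N] (A : N → N → EReal)
    (hA : ∀ i j, A i j ≠ ⊤) (x : N → EReal) :
    x ∈ mpIm (mpStar A) ↔ (∀ i, x i ≠ ⊤) ∧ ∀ i j, A i j + x j ≤ x i := by
  refine and_congr_right fun hx => ⟨?_, fun h => ⟨x, hx, ?_⟩⟩
  · rintro ⟨u, hu, rfl⟩ i j
    refine ereal_add_iSup_le (hA i j) _ fun l => ?_
    refine le_trans ?_ (le_iSup (fun l => mpStar A i l + u l) l)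
    rw [← add_assoc]
    refine add_le_add_left (ereal_add_iSup_le (hA i j) _ fun k => ?_) _
    exact (add_mpPow_le_mpPow_succ A hA k i j l).trans (le_iSup (fun k => mpPow A k i l) (k + 1))
  · have hpow : ∀ k i j, mpPow A k i j + x j ≤ x i := by
      intro k
      induction k with
      | zero =>
        intro i j
        by_cases hij : i = j
        · subst hij; simp [mpPow, mpId]
        · simp [mpPow, mpId, hij]
      | succ k ih =>
        intro i j
        rw [add_comm]
        refine ereal_add_iSup_le (hx j) _ fun m => ?_
        calc x j + (mpPow A k i m + A m j) = mpPow A k i m + (A m j + x j) := by abel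
          _ ≤ mpPow A k i m + x m := add_le_add_right (h m j) _
          _ ≤ x i := ih i m
    funext i
    refine le_antisymm ?_ (iSup_le fun j => ?_)
    · calc x i = mpPow A 0 i i + x i := by simp [mpPow, mpId]
        _ ≤ mpStar A i i + x i := add_le_add_left (le_iSup (fun k => mpPow A k i i) 0) _
        _ ≤ _ := le_iSup (fun j => mpStar A i j + x j) i
    · rw [add_comm]
      exact ereal_add_iSup_le (hx j) _ fun k => by rw [add_comm]; exact hpow k i j

lemma mem_Kset_iff {L C R : Fin n → Fin n → EReal}
    (hL : ∀ i j, L i j ≠ ⊤) (hC : ∀ i j, C i j ≠ ⊤) (hR : ∀ i j, R i j ≠ ⊤)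
    (x : Fin n ⊕ Fin n → EReal) :
    x ∈ Kset L C R ↔ (∀ p, x p ≠ ⊤) ∧ ∀ p q, Hmat L C R p q + x q ≤ x p := by
  refine mem_mpIm_mpStar_iff _ ?_ x
  rintro (i | i) (j | j)
  exacts [hC i j, hL i j, hR i j, hC i j]

lemma mpMulVec_mpId {N : Type*} [DecidableEq N] (x : N → EReal) : mpMulVec mpId x = x := by
  funext i
  refine le_antisymm (iSup_le fun j => ?_) ?_
  · by_cases h : i = j
    · subst h; simp [mpId]
    · simp [mpId, h]
  · exact le_trans (le_of_eq (by simp [mpId])) (le_iSup (fun j => mpId i j + x j) i)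

/-- One step of the lifted system shifts the second block into the first. -/
lemma max_Abar_Bbar (x : Fin n ⊕ Fin n → EReal) (u : Fin n → EReal) :
    (fun p => max (mpMulVec (Abar n) x p) (mpMulVec (Bbar n) u p)) =
      Sum.elim (fun i => x (Sum.inr i)) u := by
  funext p
  cases p with
  | inl i =>
    have h1 : mpMulVec (Abar n) x (Sum.inl i) = x (Sum.inr i) := by
      refine Eq.trans ?_ (congrFun (mpMulVec_mpId fun i => x (Sum.inr i)) i)
      simp [mpMulVec, Abar, iSup_sum]
    have h2 : mpMulVec (Bbar n) u (Sum.inl i) = ⊥ := by simp [mpMulVec, Bbar]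
    simp [h1, h2]
  | inr i =>
    have h1 : mpMulVec (Abar n) x (Sum.inr i) = ⊥ := by simp [mpMulVec, Abar]
    have h2 : mpMulVec (Bbar n) u (Sum.inr i) = u i := congrFun (mpMulVec_mpId u) i
    simp [h1, h2]

lemma mem_mpPhi_iff (X : Set (Fin n ⊕ Fin n → EReal)) (x : Fin n ⊕ Fin n → EReal) :
    x ∈ mpPhi (Abar n) (Bbar n) X ↔ x ∈ X ∧ (∀ p, x p ≠ ⊤) ∧
      ∃ u : Fin n → EReal, (∀ j, u j ≠ ⊤) ∧ Sum.elim (fun i => x (Sum.inr i)) u ∈ X := by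
  simp only [mpPhi, Set.mem_inter_iff, Set.mem_ofPred_eq, max_Abar_Bbar]

lemma mpTraj_shift {N M : Type*} (A : N → N → EReal) (B : N → M → EReal)
    (x : N → EReal) (u : ℕ → M → EReal) (k : ℕ) :
    mpTraj A B (mpTraj A B x u 1) (fun k => u (k + 1)) k = mpTraj A B x u (k + 1) := by
  induction k with
  | zero => rfl
  | succ k ih => rw [mpTraj, ih]; rfl

lemma mpTraj_succ (x : Fin n ⊕ Fin n → EReal) (u : ℕ → Fin n → EReal) (k : ℕ) :
    mpTraj (Abar n) (Bbar n) x u (k + 1) =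
      Sum.elim (fun i => mpTraj (Abar n) (Bbar n) x u k (Sum.inr i)) (u k) := by
  rw [mpTraj, max_Abar_Bbar]

lemma mpKsharp_subset_iterate {X : Set (Fin n ⊕ Fin n → EReal)}
    (hX : ∀ x ∈ X, ∀ p, x p ≠ ⊤) (k : ℕ) :
    mpKsharp (Abar n) (Bbar n) X ⊆ (mpPhi (Abar n) (Bbar n))^[k] X := by
  induction k with
  | zero => exact fun x hx => hx.1
  | succ k ih =>
    intro x hx
    rw [Function.iterate_succ_apply', mem_mpPhi_iff]
    refine ⟨ih hx, hX x hx.1, ?_⟩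
    obtain ⟨hxX, u, hu, ht⟩ := hx
    refine ⟨u 0, hu 0, ih ?_⟩
    have h1 : mpTraj (Abar n) (Bbar n) x u 1 = Sum.elim (fun i => x (Sum.inr i)) (u 0) :=
      mpTraj_succ x u 0
    rw [← h1]
    exact ⟨ht 1, fun k => u (k + 1), fun k => hu (k + 1), fun k => by
      rw [mpTraj_shift]; exact ht (k + 1)⟩

lemma iterate_mpPhi_antitone (X : Set (Fin n ⊕ Fin n → EReal)) :
    Antitone fun k => (mpPhi (Abar n) (Bbar n))^[k] X := by
  refine antitone_nat_of_succ_le fun k => ?_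
  rw [Function.iterate_succ_apply']
  exact Set.inter_subset_left

end Vectors

section Semimodule

variable {n : ℕ}

lemma isSemimodule_mpPhi {X : Set (Fin n ⊕ Fin n → EReal)} (hX : IsSemimodule X) :
    IsSemimodule (mpPhi (Abar n) (Bbar n) X) := by
  obtain ⟨htop, hmax, hadd⟩ := hX
  simp only [IsSemimodule, mem_mpPhi_iff]
  refine ⟨fun x hx => hx.2.1, ?_, ?_⟩
  · rintro x ⟨hx, -, u, hu, hxu⟩ y ⟨hy, -, v, hv, hyv⟩
    refine ⟨hmax x hx y hy, htop _ (hmax x hx y hy), fun i => max (u i) (v i), ?_, ?_⟩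
    · intro j
      exact htop _ (hmax _ hxu _ hyv) (Sum.inr j)
    · convert hmax _ hxu _ hyv using 1
      funext p
      cases p <;> rfl
  · rintro x ⟨hx, -, u, hu, hxu⟩ r hr
    refine ⟨hadd x hx r hr, htop _ (hadd x hx r hr), fun i => r + u i, ?_, ?_⟩
    · intro j
      exact htop _ (hadd _ hxu r hr) (Sum.inr j)
    · convert hadd _ hxu r hr using 1
      funext p
      cases p <;> rfl

lemma isSemimodule_Kset {L C R : Fin n → Fin n → EReal}
    (hL : ∀ i j, L i j ≠ ⊤) (hC : ∀ i j, C i j ≠ ⊤) (hR : ∀ i j, R i j ≠ ⊤) :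
    IsSemimodule (Kset L C R) := by
  simp only [IsSemimodule, mem_Kset_iff hL hC hR]
  refine ⟨fun x hx => hx.1, ?_, ?_⟩
  · rintro x ⟨hx, hHx⟩ y ⟨hy, hHy⟩
    refine ⟨fun p => ?_, fun p q => ?_⟩
    · rcases max_choice (x p) (y p) with h | h <;> rw [h]
      exacts [hx p, hy p]
    · rcases max_choice (x q) (y q) with h | h <;> rw [h]
      exacts [(hHx p q).trans (le_max_left _ _), (hHy p q).trans (le_max_right _ _)]
  · rintro x ⟨hx, hHx⟩ r hr
    refine ⟨fun p => EReal.add_ne_top hr (hx p), fun p q => ?_⟩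
    rw [add_left_comm]
    exact add_le_add_right (hHx p q) r

lemma isSemimodule_iterate_mpPhi {X : Set (Fin n ⊕ Fin n → EReal)} (hX : IsSemimodule X)
    (k : ℕ) : IsSemimodule ((mpPhi (Abar n) (Bbar n))^[k] X) := by
  induction k with
  | zero => exact hX
  | succ k ih => rw [Function.iterate_succ_apply']; exact isSemimodule_mpPhi ih

/-- In a semimodule fixed by `φ` that contains a real vector, every real state has a real
successor. -/
lemma IsSemimodule.exists_real_successor {X : Set (Fin n ⊕ Fin n → EReal)}
    (hX : IsSemimodule X) (hfix : mpPhi (Abar n) (Bbar n) X = X)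
    {y : Fin n ⊕ Fin n → EReal} (hy : y ∈ X) (hyr : y ∈ RealVecs)
    {x : Fin n ⊕ Fin n → EReal} (hx : x ∈ X) (hxr : x ∈ RealVecs) :
    ∃ z ∈ X, z ∈ RealVecs ∧ ∀ i, z (Sum.inl i) = x (Sum.inr i) := by
  rw [← hfix, mem_mpPhi_iff] at hx
  obtain ⟨-, -, u, hu, hxu⟩ := hx
  obtain ⟨r, hr⟩ : ∃ r : ℝ, ∀ i : Fin n,
      (r : EReal) + y (Sum.inl i) ≤ x (Sum.inr i) := by
    obtain ⟨s, hs⟩ := (Set.finite_range fun i : Fin n =>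
      (x (Sum.inr i)).toReal - (y (Sum.inl i)).toReal).bddBelow
    refine ⟨s, fun i => ?_⟩
    have h := hs ⟨i, rfl⟩
    have h1 := hxr (Sum.inr i)
    have h2 := hyr (Sum.inl i)
    rw [← EReal.coe_toReal h1.1 h1.2, ← EReal.coe_toReal h2.1 h2.2]
    simp only at h
    exact_mod_cast (by linarith : s + (y (Sum.inl i)).toReal ≤ (x (Sum.inr i)).toReal)
  have hz := hX.2.1 _ hxu _ (hX.2.2 y hy r (EReal.coe_ne_top r))
  refine ⟨_, hz, fun p => ⟨hX.1 _ hz p, fun hbot => ?_⟩, fun i => ?_⟩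
  · have := (max_eq_bot.1 hbot).2
    rw [EReal.add_eq_bot_iff] at this
    exact this.elim (EReal.coe_ne_bot r) (hyr p).2
  · exact max_eq_left (hr i)

end Semimodule

lemma consistent_of_iterate_eq {n : ℕ} {L C R : Fin n → Fin n → EReal}
    (hL : ∀ i j, L i j ≠ ⊤) (hC : ∀ i j, C i j ≠ ⊤) (hR : ∀ i j, R i j ≠ ⊤) (m : ℕ)
    (hfix : (mpPhi (Abar n) (Bbar n))^[m + 1] (Kset L C R) =
      (mpPhi (Abar n) (Bbar n))^[m] (Kset L C R))
    {y : Fin n ⊕ Fin n → EReal} (hy : y ∈ mpKsharp (Abar n) (Bbar n) (Kset L C R))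
    (hyr : y ∈ RealVecs) : Consistent L C R := by
  have hK := isSemimodule_Kset hL hC hR
  have hX := isSemimodule_iterate_mpPhi hK m
  have hyX := mpKsharp_subset_iterate hK.1 m hy
  have hXK := iterate_mpPhi_antitone (Kset L C R) (Nat.zero_le m)
  rw [Function.iterate_succ_apply'] at hfix
  set X := (mpPhi (Abar n) (Bbar n))^[m] (Kset L C R)
  choose f hf using fun x : {x // x ∈ X ∧ x ∈ RealVecs} =>
    hX.exists_real_successor hfix hyX hyr x.2.1 x.2.2
  let s : ℕ → {x // x ∈ X ∧ x ∈ RealVecs} := fun k =>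
    Nat.rec ⟨y, hyX, hyr⟩ (fun _ x => ⟨f x, (hf x).1, (hf x).2.1⟩) k
  have hs : ∀ k i, (s (k + 1)).1 (Sum.inl i) = (s k).1 (Sum.inr i) := fun k i =>
    (hf (s k)).2.2 i
  have hcoe : ∀ k p, (((s k).1 p).toReal : EReal) = (s k).1 p :=
    fun k p => EReal.coe_toReal ((s k).2.2 _).1 ((s k).2.2 _).2
  refine ⟨fun k i => ((s k).1 (Sum.inl i)).toReal, fun k => ?_⟩
  have hH := ((mem_Kset_iff hL hC hR _).1 (hXK (s k).2.1)).2
  simp only [mpMulVec_le_iff, hcoe, hs]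
  exact ⟨fun i j => hH (Sum.inl i) (Sum.inr j), fun i j => hH (Sum.inl i) (Sum.inl j),
    fun i j => hH (Sum.inr i) (Sum.inl j)⟩

/-- `Excursion L C R h i j w`: the graph of `M_[∞]` has a path of weight `w` from node `i` to
node `j` of the bottom level that climbs at most `h` levels. -/
inductive Excursion {n : ℕ} (L C R : Fin n → Fin n → EReal) :
    ℕ → Fin n → Fin n → ℝ → Prop
  | nil (h : ℕ) (i : Fin n) : Excursion L C R h i i 0
  | level {h : ℕ} {i j k : Fin n} {w c : ℝ} (hw : Excursion L C R h i j w)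
      (hc : C k j = c) : Excursion L C R h i k (w + c)
  | climb {h : ℕ} {i j k a b : Fin n} {w r v l : ℝ} (hw : Excursion L C R (h + 1) i j w)
      (hr : R a j = r) (hv : Excursion L C R h a b v) (hl : L k b = l) :
      Excursion L C R (h + 1) i k (w + r + v + l)

namespace Excursion

variable {n : ℕ} {L C R : Fin n → Fin n → EReal}

lemma mono {h h' : ℕ} {i j : Fin n} {w : ℝ} (hw : Excursion L C R h i j w) (hh : h ≤ h') :
    Excursion L C R h' i j w := by
  induction hw generalizing h' with
  | nil => exact .nil _ _
  | level _ hc ih => exact .level (ih hh) hc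
  | climb _ hr _ hl ih ih' =>
    obtain ⟨h', rfl⟩ := Nat.exists_eq_succ_of_ne_zero (by omega : h' ≠ 0)
    exact .climb (ih hh) hr (ih' (by omega)) hl

lemma trans {h : ℕ} {i j k : Fin n} {v w : ℝ} (hv : Excursion L C R h i j v)
    (hw : Excursion L C R h j k w) : Excursion L C R h i k (v + w) := by
  induction hw with
  | nil => simpa using hv
  | level _ hc ih => rw [← add_assoc]; exact .level (ih hv) hc
  | climb _ hr h' hl ih _ =>
    simp only [← add_assoc]
    exact .climb (ih hv) hr h' hl

lemma le_of_trajectory {y : ℕ → Fin n → ℝ}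
    (hL : ∀ k i j, L i j + (y (k + 1) j : EReal) ≤ y k i)
    (hC : ∀ k i j, C i j + (y k j : EReal) ≤ y k i)
    (hR : ∀ k i j, R i j + (y k j : EReal) ≤ y (k + 1) i)
    {h : ℕ} {i j : Fin n} {w : ℝ} (hw : Excursion L C R h i j w) (t : ℕ) :
    w + y t i ≤ y t j := by
  induction hw generalizing t with
  | nil => simp
  | @level _ _ j k w c _ hc ih =>
    have h1 := hC t k j
    rw [hc] at h1
    have h2 : c + y t j ≤ y t k := by exact_mod_cast h1
    linarith [ih t]
  | @climb _ _ j k a b w r v l _ hr _ hl ih ih' =>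
    have h1 := hR t a j
    rw [hr] at h1
    have h2 : r + y t j ≤ y (t + 1) a := by exact_mod_cast h1
    have h3 := hL t k b
    rw [hl] at h3
    have h4 : l + y (t + 1) b ≤ y t k := by exact_mod_cast h3
    linarith [ih t, ih' (t + 1)]

/-- The excursion weight `w` at height `h` is not reached at any smaller height. -/
def IsNew (L C R : Fin n → Fin n → EReal) (h : ℕ) (s : Fin n × Fin n) (w : ℝ) : Prop :=
  Excursion L C R h s.1 s.2 w ∧ ∀ k < h, ∀ w', Excursion L C R k s.1 s.2 w' → w' < w

/-- Excursions for `s` of height `h' ≥ h` can be completed to excursions for `s'` of height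
`h' + d` at the cost of a constant weight `c`. -/
def Completes (L C R : Fin n → Fin n → EReal) (h d : ℕ) (s s' : Fin n × Fin n) (c : ℝ) : Prop :=
  ∀ h' ≥ h, ∀ v, Excursion L C R h' s.1 s.2 v → Excursion L C R (h' + d) s'.1 s'.2 (v + c)

lemma exists_le_or_exists_isNew {h : ℕ} {i j : Fin n} {w : ℝ}
    (hw : Excursion L C R (h + 1) i j w) :
    (∃ w', w ≤ w' ∧ Excursion L C R h i j w') ∨
      ∃ s v, IsNew L C R h s v ∧ Completes L C R h 1 s (i, j) (w - v) := by
  generalize hH : h + 1 = H at hw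
  induction hw with
  | nil => exact .inl ⟨0, le_rfl, .nil _ _⟩
  | level _ hc ih =>
    rcases ih hH with ⟨w', hle, hw'⟩ | ⟨s, v, hs, hcomp⟩
    · exact .inl ⟨_, add_le_add_left hle _, .level hw' hc⟩
    · refine .inr ⟨s, v, hs, fun h' hh' v' hv' => ?_⟩
      convert Excursion.level (hcomp h' hh' v' hv') hc using 1
      ring
  | @climb h₁ i j k a b w r v l hw hr hv hl ih _ =>
    obtain rfl : h = h₁ := by omega
    rcases ih rfl with ⟨w', hle, hw'⟩ | ⟨s, v', hs, hcomp⟩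
    · by_cases hnew : IsNew L C R h (a, b) v
      · refine .inr ⟨(a, b), v, hnew, fun h' hh' v' hv' => ?_⟩
        convert Excursion.climb (hw.mono (Nat.succ_le_succ hh')) hr hv' hl using 1
        ring
      · simp only [IsNew, hv, true_and] at hnew
        push Not at hnew
        obtain ⟨k', hk', v', hv', hvv'⟩ := hnew
        obtain ⟨h, rfl⟩ := Nat.exists_eq_succ_of_ne_zero (by omega : h ≠ 0)
        exact .inl ⟨w' + r + v' + l, by linarith,
          .climb hw' hr (hv'.mono (Nat.lt_succ_iff.1 hk')) hl⟩
    · refine .inr ⟨s, v', hs, fun h' hh' x hx => ?_⟩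
      convert Excursion.climb (hcomp h' hh' x hx) hr (hv.mono hh') hl using 1
      ring

lemma IsNew.exists_chain {h : ℕ} {s : Fin n × Fin n} {w : ℝ} (hw : IsNew L C R h s w) :
    ∃ (σ : ℕ → Fin n × Fin n) (v : ℕ → ℝ), σ h = s ∧ v h = w ∧
      (∀ k ≤ h, IsNew L C R k (σ k) (v k)) ∧
      ∀ k < h, Completes L C R k 1 (σ k) (σ (k + 1)) (v (k + 1) - v k) := by
  induction h generalizing s w with
  | zero =>
    refine ⟨fun _ => s, fun _ => w, rfl, rfl, fun k hk => ?_, fun k hk => by omega⟩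
    obtain rfl : k = 0 := by omega
    exact hw
  | succ h ih =>
    rcases exists_le_or_exists_isNew hw.1 with ⟨w', hle, hw'⟩ | ⟨s', v', hs', hcomp⟩
    · exact absurd (hw.2 h h.lt_succ_self w' hw') (not_lt.2 hle)
    · obtain ⟨σ, v, rfl, rfl, hnew, hc⟩ := ih hs'
      refine ⟨Function.update σ (h + 1) s, Function.update v (h + 1) w, by simp, by simp,
        fun k hk => ?_, fun k hk => ?_⟩
      · rcases hk.lt_or_eq with hk | rfl
        · simpa [Function.update_of_ne hk.ne] using hnew k (by omega)
        · simpa using hw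
      · rcases (Nat.lt_succ_iff.1 hk).lt_or_eq with hk' | rfl
        · have h1 : k ≠ h + 1 := by omega
          have h2 : k + 1 ≠ h + 1 := by omega
          simpa only [Function.update_of_ne h1, Function.update_of_ne h2] using hc k hk'
        · have h1 : k ≠ k + 1 := by omega
          simpa only [Function.update_of_ne h1, Function.update_self] using hcomp

lemma Completes.chain {h : ℕ} {σ : ℕ → Fin n × Fin n} {v : ℕ → ℝ}
    (hc : ∀ k < h, Completes L C R k 1 (σ k) (σ (k + 1)) (v (k + 1) - v k))
    (a d : ℕ) (had : a + d ≤ h) : Completes L C R a d (σ a) (σ (a + d)) (v (a + d) - v a) := by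
  induction d with
  | zero => intro h' _ x hx; simpa using hx
  | succ d ih =>
    rw [show a + (d + 1) = a + d + 1 from rfl]
    intro h' hh' x hx
    convert hc (a + d) (by omega) (h' + d) (by omega) _ (ih (by omega) h' hh' x hx) using 1
    · rfl
    · ring

lemma Completes.iterate {h d : ℕ} {s : Fin n × Fin n} {c v : ℝ}
    (hc : Completes L C R h d s s c) (hv : Excursion L C R h s.1 s.2 v) (N : ℕ) :
    Excursion L C R (h + N * d) s.1 s.2 (v + N * c) := by
  induction N with
  | zero => simpa using hv
  | succ N ih =>
    convert hc _ (Nat.le_add_right h _) _ ih using 1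
    · ring
    · push_cast; ring

/-- If excursion weights are bounded, then every weight is reached at height `n² - 1`. -/
lemma exists_le_of_bounded
    (hbdd : ∀ i j, ∃ B : ℝ, ∀ h w, Excursion L C R h i j w → w ≤ B)
    {h : ℕ} {i j : Fin n} {w : ℝ} (hw : Excursion L C R h i j w) :
    ∃ w', w ≤ w' ∧ Excursion L C R (n ^ 2 - 1) i j w' := by
  induction h generalizing w with
  | zero => exact ⟨w, le_rfl, hw.mono (Nat.zero_le _)⟩
  | succ h ih =>
    by_cases hh : h + 1 ≤ n ^ 2 - 1
    · exact ⟨w, le_rfl, hw.mono hh⟩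
    by_cases hnew : IsNew L C R (h + 1) (i, j) w
    · exfalso
      obtain ⟨σ, v, -, -, hσ, hc⟩ := hnew.exists_chain
      obtain ⟨a, b, hab, heq⟩ : ∃ a b : Fin (h + 2), a < b ∧ σ a = σ b := by
        obtain ⟨a, b, hab, heq⟩ := Fintype.exists_ne_map_eq_of_card_lt
          (fun k : Fin (h + 2) => σ k) (by
            simp only [Fintype.card_prod, Fintype.card_fin, ← sq]; omega)
        rcases hab.lt_or_gt with hlt | hlt
        exacts [⟨a, b, hlt, heq⟩, ⟨b, a, hlt, heq.symm⟩]
      obtain ⟨d, hd⟩ := Nat.exists_eq_add_of_lt (Fin.lt_def.1 hab)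
      have hcomp := Completes.chain hc a (d + 1) (by omega)
      rw [← add_assoc, ← hd, ← heq] at hcomp
      have ha := hσ a (by omega)
      have hlt : v a < v b := (hσ b (by omega)).2 a hab _ (heq ▸ ha.1)
      obtain ⟨B, hB⟩ := hbdd (σ a).1 (σ a).2
      obtain ⟨N, hN⟩ := exists_nat_gt ((B - v a) / (v b - v a))
      rw [div_lt_iff₀ (by linarith)] at hN
      linarith [hB _ _ (hcomp.iterate ha.1 N)]
    · simp only [IsNew, hw, true_and] at hnew
      push Not at hnew
      obtain ⟨k, hk, w', hw', hle⟩ := hnew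
      obtain ⟨w'', hle', hw''⟩ := ih (hw'.mono (Nat.lt_succ_iff.1 hk))
      exact ⟨w'', hle.trans hle', hw''⟩

/-- A state surviving `k` steps of `φ` dominates all excursions of height `k` from level one. -/
lemma le_of_mem_iterate (hL : ∀ i j, L i j ≠ ⊤) (hC : ∀ i j, C i j ≠ ⊤)
    (hR : ∀ i j, R i j ≠ ⊤) {k : ℕ} {x : Fin n ⊕ Fin n → EReal}
    (hx : x ∈ (mpPhi (Abar n) (Bbar n))^[k] (Kset L C R)) {i j : Fin n} {w : ℝ}
    (hw : Excursion L C R k i j w) : (w : EReal) + x (Sum.inr i) ≤ x (Sum.inr j) := by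
  induction hw generalizing x with
  | nil => simp
  | @level h _ j m w c _ hc ih =>
    have hH := ((mem_Kset_iff hL hC hR x).1
      (iterate_mpPhi_antitone (Kset L C R) (Nat.zero_le h) hx)).2 (Sum.inr m) (Sum.inr j)
    refine le_trans (le_trans (le_of_eq ?_) (add_le_add_right (ih hx) (c : EReal))) (hc ▸ hH)
    push_cast
    abel
  | @climb h i j m a b w r v l _ hr _ hl ih ih' =>
    have hx' := hx
    rw [Function.iterate_succ_apply', mem_mpPhi_iff] at hx'
    obtain ⟨-, -, u, -, hu⟩ := hx'
    have hH := ((mem_Kset_iff hL hC hR _).1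
      (iterate_mpPhi_antitone (Kset L C R) (Nat.zero_le h) hu)).2
    have h1 : (r : EReal) + x (Sum.inr j) ≤ u a := hr ▸ hH (Sum.inr a) (Sum.inl j)
    have h2 : (l : EReal) + u b ≤ x (Sum.inr m) := hl ▸ hH (Sum.inl m) (Sum.inr b)
    have h3 : (v : EReal) + u a ≤ u b := ih' hu
    calc ((w + r + v + l : ℝ) : EReal) + x (Sum.inr i)
        = l + (v + (r + (w + x (Sum.inr i)))) := by push_cast; abel
      _ ≤ l + (v + (r + x (Sum.inr j))) := by gcongr; exact ih hx
      _ ≤ l + (v + u a) := by gcongr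
      _ ≤ l + u b := by gcongr
      _ ≤ x (Sum.inr m) := h2

/-- Conversely, a state of `K` dominating all excursions survives all steps of `φ`. -/
lemma mem_iterate_of_forall_le (hL : ∀ i j, L i j ≠ ⊤) (hC : ∀ i j, C i j ≠ ⊤)
    (hR : ∀ i j, R i j ≠ ⊤)
    (hbdd : ∀ i j, ∃ B : ℝ, ∀ h w, Excursion L C R h i j w → w ≤ B)
    (k : ℕ) {x : Fin n ⊕ Fin n → EReal} (hx : x ∈ Kset L C R)
    (hdom : ∀ h i j w, Excursion L C R h i j w →
      (w : EReal) + x (Sum.inr i) ≤ x (Sum.inr j)) :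
    x ∈ (mpPhi (Abar n) (Bbar n))^[k] (Kset L C R) := by
  induction k generalizing x with
  | zero => exact hx
  | succ k ih =>
    rw [Function.iterate_succ_apply', mem_mpPhi_iff]
    have hxK := (mem_Kset_iff hL hC hR x).1 hx
    let u : Fin n → EReal := fun i => ⨆ j, ⨆ a, ⨆ p : {p : ℕ × ℝ // Excursion L C R p.1 a i p.2},
      (p.1.2 : EReal) + (R a j + x (Sum.inr j))
    have hle : ∀ {h a i w} (j), Excursion L C R h a i w →
        (w : EReal) + (R a j + x (Sum.inr j)) ≤ u i := fun {h a i w} j hw =>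
      le_iSup_of_le j (le_iSup_of_le a (le_iSup_of_le ⟨(h, w), hw⟩ le_rfl))
    have hu_le : ∀ {i : Fin n} {c e : EReal}, c ≠ ⊤ → (∀ h a j w, Excursion L C R h a i w →
        c + ((w : EReal) + (R a j + x (Sum.inr j))) ≤ e) → c + u i ≤ e := fun hc H =>
      ereal_add_iSup_le hc _ fun j => ereal_add_iSup_le hc _ fun a =>
        ereal_add_iSup_le hc _ fun p => H _ a j _ p.2
    have hutop : ∀ i, u i ≠ ⊤ := by
      intro i
      choose B hB using hbdd
      refine ne_top_of_le_ne_top (b := Finset.univ.sup fun q : Fin n × Fin n =>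
        (B q.1 i : EReal) + (R q.1 q.2 + x (Sum.inr q.2))) ?_ ?_
      · rw [← lt_top_iff_ne_top, Finset.sup_lt_iff (by exact bot_lt_top)]
        exact fun q _ => lt_top_iff_ne_top.2 (EReal.add_ne_top (EReal.coe_ne_top _)
          (EReal.add_ne_top (hR _ _) (hxK.1 _)))
      · refine iSup_le fun j => iSup_le fun a => iSup_le fun p => ?_
        refine le_trans (add_le_add_left (EReal.coe_le_coe_iff.2 (hB a i _ _ p.2)) _) ?_
        exact Finset.le_sup (f := fun q : Fin n × Fin n =>
          (B q.1 i : EReal) + (R q.1 q.2 + x (Sum.inr q.2))) (Finset.mem_univ (a, j))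
    refine ⟨ih hx hdom, hxK.1, u, hutop, ih ?_ ?_⟩
    · rw [mem_Kset_iff hL hC hR]
      constructor
      · rintro (i | i)
        exacts [hxK.1 _, hutop i]
      · rintro (i | i) (j | j)
        · exact hxK.2 (Sum.inr i) (Sum.inr j)
        · refine hu_le (hL i j) fun h a m w hw => ?_
          change L i j + (w + (R a m + x (Sum.inr m))) ≤ x (Sum.inr i)
          by_cases hRb : R a m = ⊥
          · simp [hRb]
          by_cases hLb : L i j = ⊥
          · simp [hLb]
          have h1 := EReal.coe_toReal (hR a m) hRb
          have h2 := EReal.coe_toReal (hL i j) hLb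
          have h3 := hdom _ _ _ _ (.climb (.nil _ m) h1.symm hw h2.symm)
          refine le_trans (le_of_eq ?_) h3
          rw [← h1, ← h2]
          push_cast
          simp only [EReal.toReal_coe, zero_add]
          abel
        · change R i j + x (Sum.inr j) ≤ u i
          simpa using hle j (.nil 0 i)
        · refine hu_le (hC i j) fun h a m w hw => ?_
          change C i j + (w + (R a m + x (Sum.inr m))) ≤ u i
          by_cases hCb : C i j = ⊥
          · simp [hCb]
          have h1 := EReal.coe_toReal (hC i j) hCb
          refine le_trans (le_of_eq ?_) (hle m (.level hw h1.symm))
          rw [← h1]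
          push_cast
          simp only [EReal.toReal_coe]
          abel
    · intro h i j w hw
      refine hu_le (EReal.coe_ne_top w) fun h' a m w' hw' => ?_
      refine le_trans (le_of_eq ?_)
        (hle m ((hw'.mono (le_max_right h h')).trans (hw.mono (le_max_left h h'))))
      push_cast
      abel

end Excursion

/-- `φ^k(K)` converges in at most `n² - 1` steps and
`K^♯ ∩ ℝ^{2n} ≠ ∅` iff system (8) is consistent. -/
theorem stmt_17 (n : ℕ) (hn : 0 < n) (L C R : Fin n → Fin n → EReal)
    (hL : ∀ i j, L i j ≠ ⊤) (hC : ∀ i j, C i j ≠ ⊤) (hR : ∀ i j, R i j ≠ ⊤) :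
    ((∀ k : ℕ, n ^ 2 - 1 ≤ k →
        (mpPhi (Abar n) (Bbar n))^[k] (Kset L C R) =
          (mpPhi (Abar n) (Bbar n))^[n ^ 2 - 1] (Kset L C R)) ∧
      mpKsharp (Abar n) (Bbar n) (Kset L C R) ∩ RealVecs ≠ ∅) ↔
    Consistent L C R := by
  have hKtop := (isSemimodule_Kset hL hC hR).1
  constructor
  · rintro ⟨hconv, hne⟩
    obtain ⟨y, hy, hyr⟩ := Set.nonempty_iff_ne_empty.2 hne
    exact consistent_of_iterate_eq hL hC hR _ (hconv _ (Nat.le_succ _)) hy hyr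
  · rintro ⟨y, hy⟩
    simp only [mpMulVec_le_iff] at hy
    have hbdd : ∀ i j, ∃ B : ℝ, ∀ h w, Excursion L C R h i j w → w ≤ B := fun i j =>
      ⟨y 0 j - y 0 i, fun h w hw => by
        linarith [hw.le_of_trajectory (fun k => (hy k).1) (fun k => (hy k).2.1)
          (fun k => (hy k).2.2) 0]⟩
    refine ⟨fun k hk => (iterate_mpPhi_antitone _ hk).antisymm fun x hx => ?_, ?_⟩
    · refine Excursion.mem_iterate_of_forall_le hL hC hR hbdd k
        (iterate_mpPhi_antitone _ (Nat.zero_le _) hx) fun h i j w hw => ?_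
      obtain ⟨w', hle, hw'⟩ := Excursion.exists_le_of_bounded hbdd hw
      exact (add_le_add_left (EReal.coe_le_coe_iff.2 hle) _).trans
        (Excursion.le_of_mem_iterate hL hC hR hx hw')
    · let z : ℕ → Fin n ⊕ Fin n → EReal := fun k =>
        Sum.elim (fun i => (y k i : EReal)) (fun i => (y (k + 1) i : EReal))
      have hz : ∀ k, z k ∈ Kset L C R := by
        intro k
        rw [mem_Kset_iff hL hC hR]
        constructor
        · rintro (i | i) <;> exact EReal.coe_ne_top _
        · rintro (i | i) (j | j)
          exacts [(hy k).2.1 i j, (hy k).1 i j, (hy k).2.2 i j, (hy (k + 1)).2.1 i j]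
      let u : ℕ → Fin n → EReal := fun k i => (y (k + 2) i : EReal)
      have hu : ∀ k, mpTraj (Abar n) (Bbar n) (z 0) u k = z k := by
        intro k
        induction k with
        | zero => rfl
        | succ k ih => rw [mpTraj_succ, ih]; rfl
      refine Set.nonempty_iff_ne_empty.1 ⟨z 0, ⟨hz 0, u, fun k j => EReal.coe_ne_top _,
        fun k => hu k ▸ hz k⟩, ?_⟩
      rintro (i | i) <;> exact ⟨EReal.coe_ne_top _, EReal.coe_ne_bot _⟩
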